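/- Let x ∈ S̃_{k+1} and let x = d_{A_n} ⋯ d_{A_1} with each A_m ⊊ I nonempty and ℓ(x) = ∑_{m=1}^{n} |A_m| (a reduced decomposition into cyclically decreasing elements). Then A_{m+1} ⊆ A_m − 1 holds for all 1 ≤ m < n if and only if the decomposition is maximal, i.e., for every reduced decomposition x = d_{B_N} ⋯ d_{B_1} into cyclically decreasing elements with each B_m ⊊ I nonempty and ℓ(x) = ∑_{m=1}^{N} |B_m|, the sequence (|A_1|, |A_2|, …) is greater than or equal to (|B_1|, |B_2|, …) in lexicographic order (sequences padded with zeros). -/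

import Mathlib

/-- `x : Equiv.Perm ℤ` is an affine permutation in `S̃_{k+1}`: it commutes with
translation by `k+1` and its window sums to `(k+1)(k+2)/2`. -/
def IsAffinePerm (k : ℕ) (x : Equiv.Perm ℤ) : Prop :=
  (∀ i : ℤ, x (i + (k + 1)) = x i + (k + 1)) ∧
  ∑ i ∈ Finset.Icc (1 : ℤ) (k + 1), x i = (k + 1) * (k + 2) / 2

/-- The underlying function of the simple generator `s_i`. -/
def sAffFun (k : ℕ) (i : ZMod (k + 1)) (j : ℤ) : ℤ :=
  if (j : ZMod (k + 1)) = i then j + 1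
  else if (j : ZMod (k + 1)) = i + 1 then j - 1
  else j

theorem sAffFun_invol (k : ℕ) (i : ZMod (k + 1)) (h : ¬ (1 : ZMod (k + 1)) = 0) :
    Function.Involutive (sAffFun k i) := by
  have hne : i + 1 ≠ i := fun hc => h (by
    have h2 : i + 1 = i + 0 := by simpa using hc
    exact add_left_cancel h2)
  intro j
  by_cases h1 : (j : ZMod (k + 1)) = i
  · have e1 : sAffFun k i j = j + 1 := if_pos h1
    have hj1 : ((j + 1 : ℤ) : ZMod (k + 1)) = i + 1 := by push_cast; rw [h1]
    have e2 : sAffFun k i (j + 1) = j := by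
      unfold sAffFun
      rw [if_neg (by rw [hj1]; exact hne), if_pos hj1]
      ring
    rw [e1, e2]
  · by_cases h2 : (j : ZMod (k + 1)) = i + 1
    · have e1 : sAffFun k i j = j - 1 := by unfold sAffFun; rw [if_neg h1, if_pos h2]
      have hj1 : ((j - 1 : ℤ) : ZMod (k + 1)) = i := by push_cast; rw [h2]; ring
      have e2 : sAffFun k i (j - 1) = j := by
        unfold sAffFun; rw [if_pos hj1]; ring
      rw [e1, e2]
    · have e1 : sAffFun k i j = j := by unfold sAffFun; rw [if_neg h1, if_neg h2]
      rw [e1, e1]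

/-- The simple generator `s_i` of the affine symmetric group, as a permutation of `ℤ`:
it interchanges `m(k+1) + ī` and `m(k+1) + ī + 1` for every `m` (when `k ≥ 1`). -/
noncomputable def sAff (k : ℕ) (i : ZMod (k + 1)) : Equiv.Perm ℤ :=
  if h : (1 : ZMod (k + 1)) = 0 then 1 else Function.Involutive.toPerm _ (sAffFun_invol k i h)

/-- The Coxeter length of `x`: the least number of simple generators whose product is `x`. -/
noncomputable def affLen (k : ℕ) (x : Equiv.Perm ℤ) : ℕ :=
  sInf {n : ℕ | ∃ w : List (ZMod (k + 1)), w.length = n ∧ x = (w.map (sAff k)).prod}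

/-- The right descent set `D_R(x) = {i : ℓ(x s_i) < ℓ(x)}`. -/
noncomputable def rightDescents (k : ℕ) (x : Equiv.Perm ℤ) : Set (ZMod (k + 1)) :=
  {i | affLen k (x * sAff k i) < affLen k x}

/-- The cyclic interval `[i,j] = {i, i+1, …, j}` of residues mod `k+1`. -/
def cycInt (k : ℕ) (i j : ZMod (k + 1)) : Finset (ZMod (k + 1)) :=
  (Finset.range ((j - i).val + 1)).image fun t : ℕ => i + (t : ZMod (k + 1))

/-- A choice of a "gate" residue not belonging to `A` (when `A` is proper). -/
noncomputable def gate (k : ℕ) (A : Finset (ZMod (k + 1))) : ZMod (k + 1) :=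
  if h : ∃ g, g ∉ A then h.choose else 0

/-- The cyclically decreasing element `d_A`: the product of the `s_a`, `a ∈ A`, in an
order where `s_{a+1}` occurs to the left of `s_a` whenever `a, a+1 ∈ A`. -/
noncomputable def dElt (k : ℕ) (A : Finset (ZMod (k + 1))) : Equiv.Perm ℤ :=
  (((((List.range (k + 1)).reverse.map fun t : ℕ => gate k A + (t : ZMod (k + 1))).filter
      fun a => decide (a ∈ A)).map (sAff k)).prod)

/-- The cyclically increasing element `u_A`: the product of the `s_a`, `a ∈ A`, in an
order where `s_{a+1}` occurs to the right of `s_a` whenever `a, a+1 ∈ A`. -/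
noncomputable def uElt (k : ℕ) (A : Finset (ZMod (k + 1))) : Equiv.Perm ℤ :=
  ((((List.range (k + 1)).map fun t : ℕ => gate k A + (t : ZMod (k + 1))).filter
      fun a => decide (a ∈ A)).map (sAff k)).prod

/-- The right decreasing code: `CRD(x)_i = #{j < ī : x(j) > x(ī)}`. -/
noncomputable def CRD (k : ℕ) (x : Equiv.Perm ℤ) (i : ZMod (k + 1)) : ℕ :=
  Set.ncard {j : ℤ | j < (i.val : ℤ) ∧ x (i.val : ℤ) < x j}

/-- The right increasing code: `CRI(x)_i = #{j > ī + 1 : x(j) < x(ī + 1)}`. -/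
noncomputable def CRI (k : ℕ) (x : Equiv.Perm ℤ) (i : ZMod (k + 1)) : ℕ :=
  Set.ncard {j : ℤ | (i.val : ℤ) + 1 < j ∧ x j < x ((i.val : ℤ) + 1)}

/-- The left decreasing code: `CLD(x)_i = #{j < x⁻¹(ī + 1) : x(j) > ī + 1}`. -/
noncomputable def CLD (k : ℕ) (x : Equiv.Perm ℤ) (i : ZMod (k + 1)) : ℕ :=
  Set.ncard {j : ℤ | j < x.symm ((i.val : ℤ) + 1) ∧ (i.val : ℤ) + 1 < x j}

/-- The left increasing code: `CLI(x)_i = #{j > x⁻¹(ī) : x(j) < ī}`. -/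
noncomputable def CLI (k : ℕ) (x : Equiv.Perm ℤ) (i : ZMod (k + 1)) : ℕ :=
  Set.ncard {j : ℤ | x.symm ((i.val : ℤ)) < j ∧ x j < (i.val : ℤ)}

section PeriodicPermutations

variable {k : ℕ}

/-- Periodic permutations of `ℤ` with zero total displacement on a period. -/
def IsBalanced (k : ℕ) (x : Equiv.Perm ℤ) : Prop :=
  (∀ i : ℤ, x (i + (k + 1)) = x i + (k + 1)) ∧
  ∑ r : ZMod (k + 1), (x (r.val : ℤ) - (r.val : ℤ)) = 0

theorem apply_add_mul_period {x : Equiv.Perm ℤ}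
    (hx : ∀ i : ℤ, x (i + (k + 1)) = x i + (k + 1)) (i m : ℤ) :
    x (i + m * (k + 1)) = x i + m * (k + 1) := by
  induction m using Int.induction_on with
  | zero => simp
  | succ n ih =>
    rw [show i + ((n : ℤ) + 1) * (k + 1) = i + n * (k + 1) + (k + 1) by ring, hx, ih]; ring
  | pred n ih =>
    have h := hx (i + (-(n : ℤ) - 1) * (k + 1))
    rw [show i + (-(n : ℤ) - 1) * (k + 1) + (k + 1) = i + -(n : ℤ) * (k + 1) by ring, ih] at h
    linarith

theorem exists_eq_add_mul_period {a b : ℤ} (h : (a : ZMod (k + 1)) = b) :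
    ∃ m : ℤ, b = a + m * (k + 1) := by
  obtain ⟨m, hm⟩ := (ZMod.intCast_eq_intCast_iff_dvd_sub a b (k + 1)).mp h
  refine ⟨m, ?_⟩
  push_cast at hm
  linarith

theorem intCast_val_self (r : ZMod (k + 1)) : (((r.val : ℕ) : ℤ) : ZMod (k + 1)) = r := by
  simp

theorem displacement_eq {x : Equiv.Perm ℤ} (hx : ∀ i : ℤ, x (i + (k + 1)) = x i + (k + 1))
    {a b : ℤ} (h : (a : ZMod (k + 1)) = b) : x a - a = x b - b := by
  obtain ⟨m, rfl⟩ := exists_eq_add_mul_period h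
  rw [apply_add_mul_period hx]; ring

theorem one_ne_zero_zmod (hk : 1 ≤ k) : (1 : ZMod (k + 1)) ≠ 0 := by
  have : Fact (1 < k + 1) := ⟨by omega⟩
  exact one_ne_zero

theorem sAff_apply (hk : 1 ≤ k) (r : ZMod (k + 1)) (j : ℤ) : sAff k r j = sAffFun k r j := by
  rw [sAff, dif_neg (one_ne_zero_zmod hk)]; rfl

theorem sAff_apply_of_eq (hk : 1 ≤ k) {r : ZMod (k + 1)} {j : ℤ} (h : (j : ZMod (k + 1)) = r) :
    sAff k r j = j + 1 := by
  rw [sAff_apply hk, sAffFun, if_pos h]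

theorem sAff_apply_of_eq_add_one (hk : 1 ≤ k) {r : ZMod (k + 1)} {j : ℤ}
    (h : (j : ZMod (k + 1)) = r + 1) : sAff k r j = j - 1 := by
  rw [sAff_apply hk, sAffFun, if_neg, if_pos h]
  rw [h]; simpa using one_ne_zero_zmod hk

theorem sAff_apply_of_ne (hk : 1 ≤ k) {r : ZMod (k + 1)} {j : ℤ} (h : (j : ZMod (k + 1)) ≠ r)
    (h' : (j : ZMod (k + 1)) ≠ r + 1) : sAff k r j = j := by
  rw [sAff_apply hk, sAffFun, if_neg h, if_neg h']

theorem sAff_sAff (hk : 1 ≤ k) (r : ZMod (k + 1)) (j : ℤ) : sAff k r (sAff k r j) = j := by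
  rw [sAff_apply hk, sAff_apply hk, sAffFun_invol k r (one_ne_zero_zmod hk)]

theorem sAff_mul_self (hk : 1 ≤ k) (r : ZMod (k + 1)) : sAff k r * sAff k r = 1 := by
  ext j; simp [sAff_sAff hk]

theorem sAff_apply_cases (hk : 1 ≤ k) (r : ZMod (k + 1)) (j : ℤ) :
    sAff k r j = j + 1 ∨ sAff k r j = j - 1 ∨ sAff k r j = j := by
  by_cases h : (j : ZMod (k + 1)) = r
  · exact Or.inl (sAff_apply_of_eq hk h)
  · by_cases h' : (j : ZMod (k + 1)) = r + 1
    · exact Or.inr (Or.inl (sAff_apply_of_eq_add_one hk h'))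
    · exact Or.inr (Or.inr (sAff_apply_of_ne hk h h'))

theorem sAff_cast (hk : 1 ≤ k) (r : ZMod (k + 1)) (j : ℤ) :
    ((sAff k r j : ℤ) : ZMod (k + 1)) = Equiv.swap r (r + 1) (j : ZMod (k + 1)) := by
  by_cases h : (j : ZMod (k + 1)) = r
  · rw [sAff_apply_of_eq hk h, h, Equiv.swap_apply_left]; push_cast; rw [h]
  · by_cases h' : (j : ZMod (k + 1)) = r + 1
    · rw [sAff_apply_of_eq_add_one hk h', h', Equiv.swap_apply_right]; push_cast; rw [h']; ring
    · rw [sAff_apply_of_ne hk h h', Equiv.swap_apply_of_ne_of_ne h h']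

theorem sAff_add_period (hk : 1 ≤ k) (r : ZMod (k + 1)) (j : ℤ) :
    sAff k r (j + (k + 1)) = sAff k r j + (k + 1) := by
  have hc : ((j + (k + 1) : ℤ) : ZMod (k + 1)) = j := by
    have : ((k + 1 : ℕ) : ZMod (k + 1)) = 0 := ZMod.natCast_self _
    push_cast at this ⊢
    rw [this, add_zero]
  rw [sAff_apply hk, sAff_apply hk, sAffFun, sAffFun, hc]
  split_ifs <;> ring

theorem isBalanced_one : IsBalanced k 1 := by
  simp [IsBalanced]

theorem IsBalanced.mul_sAff (hk : 1 ≤ k) {x : Equiv.Perm ℤ} (hx : IsBalanced k x)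
    (r : ZMod (k + 1)) : IsBalanced k (x * sAff k r) := by
  refine ⟨fun i => by simp [sAff_add_period hk, hx.1], ?_⟩
  have key : ∀ q : ZMod (k + 1), (x * sAff k r) (q.val : ℤ) - (q.val : ℤ) =
      (x ((Equiv.swap r (r + 1) q).val : ℤ) - ((Equiv.swap r (r + 1) q).val : ℤ)) +
        ((if q = r then 1 else 0) - if q = r + 1 then 1 else 0) := by
    intro q
    have hne : r ≠ r + 1 := by simpa using one_ne_zero_zmod hk
    have h1 := displacement_eq hx.1 (a := sAff k r q.val)
      (b := ((Equiv.swap r (r + 1) q).val : ℤ)) (by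
        rw [sAff_cast hk, intCast_val_self, intCast_val_self])
    rw [← h1, Equiv.Perm.mul_apply]
    by_cases h : q = r
    · rw [sAff_apply_of_eq hk (by rw [intCast_val_self, h]), if_pos h, if_neg (h ▸ hne)]; ring
    · by_cases h' : q = r + 1
      · rw [sAff_apply_of_eq_add_one hk (by rw [intCast_val_self, h']), if_neg h, if_pos h']; ring
      · rw [sAff_apply_of_ne hk (by rwa [intCast_val_self]) (by rwa [intCast_val_self]),
          if_neg h, if_neg h']; ring
  rw [Finset.sum_congr rfl fun q _ => key q, Finset.sum_add_distrib,
    Equiv.sum_comp (Equiv.swap r (r + 1)) fun q : ZMod (k + 1) => x (q.val : ℤ) - (q.val : ℤ), hx.2]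
  simp

theorem IsBalanced.mul_word (hk : 1 ≤ k) (w : List (ZMod (k + 1))) {x : Equiv.Perm ℤ}
    (hx : IsBalanced k x) : IsBalanced k (x * (w.map (sAff k)).prod) := by
  induction w generalizing x with
  | nil => simpa using hx
  | cons i w ih => simpa [mul_assoc] using ih (hx.mul_sAff hk i)

/-! ### The right decreasing code -/

theorem CRD_intCast {x : Equiv.Perm ℤ} (hx : ∀ i : ℤ, x (i + (k + 1)) = x i + (k + 1)) (i : ℤ) :
    CRD k x (i : ZMod (k + 1)) = Set.ncard {j : ℤ | j < i ∧ x i < x j} := by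
  obtain ⟨m, hm⟩ := exists_eq_add_mul_period (k := k) (intCast_val_self (i : ZMod (k + 1)))
  set v : ℤ := ((i : ZMod (k + 1)).val : ℤ) with hv
  rw [CRD, ← hv, hm, ← Set.ncard_image_of_injective _ (add_left_injective (m * ((k : ℤ) + 1)))]
  congr 1
  ext j
  simp only [Set.mem_image, Set.mem_ofPred_eq]
  constructor
  · rintro ⟨j, ⟨h1, h2⟩, rfl⟩
    rw [apply_add_mul_period hx, apply_add_mul_period hx]
    exact ⟨by linarith, by linarith⟩
  · rintro ⟨h1, h2⟩
    refine ⟨j - m * (k + 1), ⟨by linarith, ?_⟩, by ring⟩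
    have h3 := apply_add_mul_period hx (j - m * (k + 1)) m
    rw [sub_add_cancel] at h3
    rw [apply_add_mul_period hx] at h2
    linarith

theorem exists_maximal_displacement {x : Equiv.Perm ℤ}
    (hx : ∀ i : ℤ, x (i + (k + 1)) = x i + (k + 1)) :
    ∃ r : ZMod (k + 1), ∀ j : ℤ, x j - j ≤ x (r.val : ℤ) - (r.val : ℤ) := by
  obtain ⟨r, hr⟩ := Finite.exists_max fun q : ZMod (k + 1) => x (q.val : ℤ) - (q.val : ℤ)
  refine ⟨r, fun j => ?_⟩
  rw [displacement_eq hx (intCast_val_self (j : ZMod (k + 1))).symm]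
  exact hr j

theorem finite_inversions {x : Equiv.Perm ℤ} (hx : ∀ i : ℤ, x (i + (k + 1)) = x i + (k + 1))
    (i : ℤ) : {j : ℤ | j < i ∧ x i < x j}.Finite := by
  obtain ⟨r, hr⟩ := exists_maximal_displacement hx
  refine (Set.finite_Ioo (x i - (x (r.val : ℤ) - (r.val : ℤ))) i).subset ?_
  rintro j ⟨h1, h2⟩
  have := hr j
  exact ⟨by linarith, h1⟩

theorem exists_CRD_eq_zero {x : Equiv.Perm ℤ} (hx : ∀ i : ℤ, x (i + (k + 1)) = x i + (k + 1)) :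
    ∃ r : ZMod (k + 1), CRD k x r = 0 := by
  obtain ⟨r, hr⟩ := exists_maximal_displacement hx
  refine ⟨r, ?_⟩
  rw [CRD, Set.ncard_eq_zero (finite_inversions hx _), Set.eq_empty_iff_forall_notMem]
  rintro j ⟨h1, h2⟩
  have := hr j
  linarith

theorem sAff_lt_sAff (hk : 1 ≤ k) (r : ZMod (k + 1)) {a b : ℤ} (h : sAff k r a ≠ b) (hab : a < b) :
    sAff k r a < sAff k r b := by
  have h1 := sAff_apply_cases hk r a
  have h2 := sAff_apply_cases hk r b
  have h3 : sAff k r a ≠ sAff k r b := fun hc => hab.ne ((sAff k r).injective hc)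
  omega

theorem sAff_lt_sAff_iff (hk : 1 ≤ k) (r : ZMod (k + 1)) {a b : ℤ} (h : sAff k r a ≠ b) :
    sAff k r a < sAff k r b ↔ a < b := by
  refine ⟨fun hs => ?_, sAff_lt_sAff hk r h⟩
  have := sAff_lt_sAff hk r (a := sAff k r a) (b := sAff k r b)
    (fun hc => h (by rw [sAff_sAff hk] at hc; rw [hc, sAff_sAff hk])) hs
  rwa [sAff_sAff hk, sAff_sAff hk] at this

theorem ncard_inversions_mul_sAff (hk : 1 ≤ k) {y : Equiv.Perm ℤ}
    (hy : ∀ i : ℤ, y (i + (k + 1)) = y i + (k + 1)) {r : ZMod (k + 1)}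
    (hr : ∀ i : ℤ, (i : ZMod (k + 1)) = r → y i < y (i + 1)) (m : ℤ) :
    Set.ncard {j : ℤ | j < sAff k r m ∧ (y * sAff k r) (sAff k r m) < (y * sAff k r) j} =
      Set.ncard {j : ℤ | j < m ∧ y m < y j} + if (m : ZMod (k + 1)) = r then 1 else 0 := by
  have himg : {j : ℤ | j < sAff k r m ∧ (y * sAff k r) (sAff k r m) < (y * sAff k r) j} =
      sAff k r '' {j : ℤ | sAff k r j < sAff k r m ∧ y m < y j} := by
    ext j
    simp only [Set.mem_image, Set.mem_ofPred_eq, Equiv.Perm.mul_apply, sAff_sAff hk]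
    constructor
    · rintro ⟨h1, h2⟩
      exact ⟨sAff k r j, ⟨by rwa [sAff_sAff hk], h2⟩, sAff_sAff hk r j⟩
    · rintro ⟨j, ⟨h1, h2⟩, rfl⟩
      exact ⟨h1, by rwa [sAff_sAff hk]⟩
  rw [himg, Set.ncard_image_of_injective _ (sAff k r).injective]
  split_ifs with h
  · have hm := sAff_apply_of_eq hk h
    rw [← Set.ncard_insert_of_notMem (a := m + 1) (by simp) (finite_inversions hy m)]
    congr 1
    ext j
    simp only [Set.mem_ofPred_eq, Set.mem_insert_iff]
    by_cases hj : sAff k r j = m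
    · have hj' : j = m + 1 := by rw [← hm, ← hj, sAff_sAff hk]
      subst hj'
      simp [hj, hm, hr m h]
    · rw [sAff_lt_sAff_iff hk r hj]
      have : j ≠ m + 1 := by
        rintro rfl
        exact hj (by rw [← hm, sAff_sAff hk])
      simp [this]
  · rw [add_zero]
    congr 1
    ext j
    simp only [Set.mem_ofPred_eq]
    by_cases hj : sAff k r j = m
    · have hnlt : ¬ y m < y j := by
        have hjm : j = sAff k r m := by rw [← hj, sAff_sAff hk]
        by_cases h' : (m : ZMod (k + 1)) = r + 1
        · rw [sAff_apply_of_eq_add_one hk h'] at hjm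
          have h2 := hr j (by rw [hjm]; push_cast; rw [h']; ring)
          rw [hjm, sub_add_cancel] at h2
          rw [hjm]
          exact h2.not_gt
        · rw [sAff_apply_of_ne hk h h'] at hjm
          simp [hjm]
      simp [hnlt]
    · rw [sAff_lt_sAff_iff hk r hj]

theorem CRD_mul_sAff_of_lt (hk : 1 ≤ k) {y : Equiv.Perm ℤ} (hy : IsBalanced k y) {r : ZMod (k + 1)}
    (hr : y (r.val : ℤ) < y ((r.val : ℤ) + 1)) (q : ZMod (k + 1)) :
    CRD k (y * sAff k r) (Equiv.swap r (r + 1) q) = CRD k y q + if q = r then 1 else 0 := by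
  have h := ncard_inversions_mul_sAff hk hy.1 (r := r) (fun i hi => by
    obtain ⟨m, rfl⟩ := exists_eq_add_mul_period (k := k) (a := r.val) (b := i)
      (by rw [hi, intCast_val_self])
    rw [add_right_comm, apply_add_mul_period hy.1, apply_add_mul_period hy.1]
    linarith) (q.val : ℤ)
  rw [← CRD_intCast hy.1, ← CRD_intCast (hy.mul_sAff hk r).1, sAff_cast hk, intCast_val_self] at h
  exact h

theorem CRD_le_of_lt {y : Equiv.Perm ℤ} (hy : IsBalanced k y) {r : ZMod (k + 1)}
    (hr : y (r.val : ℤ) < y ((r.val : ℤ) + 1)) : CRD k y (r + 1) ≤ CRD k y r := by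
  have h1 := CRD_intCast hy.1 (r.val : ℤ)
  have h2 := CRD_intCast hy.1 ((r.val : ℤ) + 1)
  rw [Int.cast_add, Int.cast_one, intCast_val_self] at h2
  rw [intCast_val_self] at h1
  rw [h1, h2]
  refine Set.ncard_le_ncard ?_ (finite_inversions hy.1 _)
  rintro j ⟨h3, h4⟩
  refine ⟨?_, hr.trans h4⟩
  rcases (Int.lt_add_one_iff.mp h3).lt_or_eq with h | rfl
  · exact h
  · exact absurd h4 hr.not_gt

theorem CRD_swap_of_gt (hk : 1 ≤ k) {y : Equiv.Perm ℤ} (hy : IsBalanced k y) {r : ZMod (k + 1)}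
    (hr : y ((r.val : ℤ) + 1) < y (r.val : ℤ)) (q : ZMod (k + 1)) :
    CRD k y (Equiv.swap r (r + 1) q) = CRD k (y * sAff k r) q + if q = r then 1 else 0 := by
  have e1 := sAff_apply_of_eq hk (intCast_val_self r)
  have e2 : sAff k r ((r.val : ℤ) + 1) = r.val := by rw [← e1, sAff_sAff hk]
  have h := CRD_mul_sAff_of_lt hk (hy.mul_sAff hk r) (r := r) (by
    rwa [Equiv.Perm.mul_apply, Equiv.Perm.mul_apply, e1, e2]) q
  rwa [mul_assoc, sAff_mul_self hk, mul_one] at h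

theorem CRD_lt_of_gt (hk : 1 ≤ k) {y : Equiv.Perm ℤ} (hy : IsBalanced k y) {r : ZMod (k + 1)}
    (hr : y ((r.val : ℤ) + 1) < y (r.val : ℤ)) : CRD k y r < CRD k y (r + 1) := by
  have hne : r + 1 ≠ r := by simpa using one_ne_zero_zmod hk
  have e1 := sAff_apply_of_eq hk (intCast_val_self r)
  have e2 : sAff k r ((r.val : ℤ) + 1) = r.val := by rw [← e1, sAff_sAff hk]
  have h1 := CRD_swap_of_gt hk hy hr r
  have h2 := CRD_swap_of_gt hk hy hr (r + 1)
  have h3 := CRD_le_of_lt (hy.mul_sAff hk r) (r := r) (by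
    rwa [Equiv.Perm.mul_apply, Equiv.Perm.mul_apply, e1, e2])
  simp only [Equiv.swap_apply_left, Equiv.swap_apply_right, if_true, hne, if_false] at h1 h2
  omega

theorem CRD_mul_sAff (hk : 1 ≤ k) {y : Equiv.Perm ℤ} (hy : IsBalanced k y) {r : ZMod (k + 1)}
    (hr : CRD k y (r + 1) ≤ CRD k y r) (q : ZMod (k + 1)) :
    CRD k (y * sAff k r) (Equiv.swap r (r + 1) q) = CRD k y q + if q = r then 1 else 0 := by
  refine CRD_mul_sAff_of_lt hk hy ?_ q
  rcases lt_trichotomy (y (r.val : ℤ)) (y ((r.val : ℤ) + 1)) with h | h | h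
  · exact h
  · have := y.injective h
    omega
  · exact absurd (CRD_lt_of_gt hk hy h) hr.not_gt

theorem CRD_swap (hk : 1 ≤ k) {y : Equiv.Perm ℤ} (hy : IsBalanced k y) {r : ZMod (k + 1)}
    (hr : CRD k y r < CRD k y (r + 1)) (q : ZMod (k + 1)) :
    CRD k y (Equiv.swap r (r + 1) q) = CRD k (y * sAff k r) q + if q = r then 1 else 0 := by
  refine CRD_swap_of_gt hk hy ?_ q
  rcases lt_trichotomy (y (r.val : ℤ)) (y ((r.val : ℤ) + 1)) with h | h | h
  · exact absurd (CRD_le_of_lt hy h) hr.not_ge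
  · have := y.injective h
    omega
  · exact h

theorem eq_one_of_CRD_antitone (hk : 1 ≤ k) {x : Equiv.Perm ℤ} (hx : IsBalanced k x)
    (h : ∀ r : ZMod (k + 1), CRD k x (r + 1) ≤ CRD k x r) : x = 1 := by
  have hmono : StrictMono x := by
    refine strictMono_int_of_lt_succ fun i => ?_
    obtain ⟨m, hm⟩ := exists_eq_add_mul_period (k := k) (intCast_val_self (i : ZMod (k + 1)))
    set r := (i : ZMod (k + 1))
    rw [hm, add_right_comm, apply_add_mul_period hx.1, apply_add_mul_period hx.1]
    rcases lt_trichotomy (x (r.val : ℤ)) (x ((r.val : ℤ) + 1)) with h1 | h1 | h1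
    · linarith
    · have := x.injective h1
      omega
    · exact absurd (CRD_lt_of_gt hk hx h1) (h r).not_gt
  have hsucc : ∀ i : ℤ, x (i + 1) = x i + 1 := by
    intro i
    obtain ⟨j, hj⟩ := x.surjective (x i + 1)
    have h1 : i < j := hmono.lt_iff_lt.mp (by omega)
    have h2 : x i < x (i + 1) := hmono (by omega)
    have h3 : x (i + 1) ≤ x j := hmono.monotone (by omega)
    omega
  have hconst : ∀ i : ℤ, x i = x 0 + i := by
    intro i
    induction i using Int.induction_on with
    | zero => simp
    | succ n ih => rw [hsucc, ih]; ring
    | pred n ih =>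
      have := hsucc (-(n : ℤ) - 1)
      rw [sub_add_cancel, ih] at this
      linarith
  have h0 : x 0 = 0 := by
    have hs := hx.2
    rw [Finset.sum_congr rfl fun (q : ZMod (k + 1)) _ =>
      show x (q.val : ℤ) - (q.val : ℤ) = x 0 by rw [hconst]; ring] at hs
    simp only [Finset.sum_const, Finset.card_univ, ZMod.card, nsmul_eq_mul, mul_eq_zero] at hs
    exact hs.resolve_left (by positivity)
  ext i
  rw [hconst, h0, zero_add]; rfl

/-- The number of inversions per period, i.e. the size of the right decreasing code. -/
noncomputable def codeSize (k : ℕ) (x : Equiv.Perm ℤ) : ℕ := ∑ r : ZMod (k + 1), CRD k x r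

theorem codeSize_one : codeSize k 1 = 0 := by
  refine Finset.sum_eq_zero fun r _ => ?_
  rw [CRD, Set.ncard_eq_zero (finite_inversions (isBalanced_one (k := k)).1 _),
    Set.eq_empty_iff_forall_notMem]
  rintro j ⟨h1, h2⟩
  exact absurd h2 h1.not_gt

theorem codeSize_mul_sAff (hk : 1 ≤ k) {y : Equiv.Perm ℤ} (hy : IsBalanced k y) {r : ZMod (k + 1)}
    (hr : CRD k y (r + 1) ≤ CRD k y r) : codeSize k (y * sAff k r) = codeSize k y + 1 := by
  rw [codeSize, ← Equiv.sum_comp (Equiv.swap r (r + 1)),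
    Finset.sum_congr rfl fun q _ => CRD_mul_sAff hk hy hr q, Finset.sum_add_distrib]
  simp [codeSize]

theorem codeSize_eq_mul_sAff_add_one (hk : 1 ≤ k) {y : Equiv.Perm ℤ} (hy : IsBalanced k y)
    {r : ZMod (k + 1)} (hr : CRD k y r < CRD k y (r + 1)) :
    codeSize k y = codeSize k (y * sAff k r) + 1 := by
  rw [codeSize, ← Equiv.sum_comp (Equiv.swap r (r + 1)),
    Finset.sum_congr rfl fun q _ => CRD_swap hk hy hr q, Finset.sum_add_distrib]
  simp [codeSize]

theorem codeSize_mul_sAff_le (hk : 1 ≤ k) {y : Equiv.Perm ℤ} (hy : IsBalanced k y)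
    (r : ZMod (k + 1)) : codeSize k (y * sAff k r) ≤ codeSize k y + 1 := by
  rcases le_or_gt (CRD k y (r + 1)) (CRD k y r) with h | h
  · exact (codeSize_mul_sAff hk hy h).le
  · have := codeSize_eq_mul_sAff_add_one hk hy h
    omega

theorem codeSize_mul_word_le (hk : 1 ≤ k) (w : List (ZMod (k + 1))) {y : Equiv.Perm ℤ}
    (hy : IsBalanced k y) :
    codeSize k (y * (w.map (sAff k)).prod) ≤ codeSize k y + w.length := by
  induction w generalizing y with
  | nil => simp
  | cons i w ih =>
    have h1 := ih (hy.mul_sAff hk i)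
    have h2 := codeSize_mul_sAff_le hk hy i
    rw [List.map_cons, List.prod_cons, ← mul_assoc, List.length_cons]
    omega

theorem exists_word_of_codeSize (hk : 1 ≤ k) {x : Equiv.Perm ℤ} (hx : IsBalanced k x) :
    ∃ w : List (ZMod (k + 1)), w.length = codeSize k x ∧ x = (w.map (sAff k)).prod := by
  by_cases h : ∀ r : ZMod (k + 1), CRD k x (r + 1) ≤ CRD k x r
  · rw [eq_one_of_CRD_antitone hk hx h]
    exact ⟨[], by simp [codeSize_one], by simp⟩
  · push Not at h
    obtain ⟨r, hr⟩ := h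
    have hs := codeSize_eq_mul_sAff_add_one hk hx hr
    obtain ⟨w, hw, hxw⟩ := exists_word_of_codeSize hk (hx.mul_sAff hk r)
    refine ⟨w ++ [r], by simp [hw, hs], ?_⟩
    rw [List.map_append, List.prod_append, ← hxw, List.map_singleton, List.prod_singleton,
      mul_assoc, sAff_mul_self hk, mul_one]
termination_by codeSize k x

theorem affLen_eq_codeSize (hk : 1 ≤ k) {x : Equiv.Perm ℤ} (hx : IsBalanced k x) :
    affLen k x = codeSize k x := by
  refine le_antisymm (Nat.sInf_le (exists_word_of_codeSize hk hx)) ?_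
  obtain ⟨w, hw, hxw⟩ := Nat.sInf_mem
    (s := {n : ℕ | ∃ w : List (ZMod (k + 1)), w.length = n ∧ x = (w.map (sAff k)).prod})
    ⟨_, exists_word_of_codeSize hk hx⟩
  have := codeSize_mul_word_le hk w (isBalanced_one (k := k))
  rw [one_mul, ← hxw, codeSize_one, hw] at this
  simpa [affLen] using this

/-! ### Cyclically decreasing elements -/

/-- The reduced word of the cyclically decreasing element `d_A`. -/
noncomputable def decWord (k : ℕ) (A : Finset (ZMod (k + 1))) : List (ZMod (k + 1)) :=
  ((List.range (k + 1)).reverse.map fun t : ℕ => gate k A + (t : ZMod (k + 1))).filter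
    fun a => decide (a ∈ A)

theorem dElt_eq_prod_decWord (A : Finset (ZMod (k + 1))) :
    dElt k A = ((decWord k A).map (sAff k)).prod := rfl

theorem gate_notMem {A : Finset (ZMod (k + 1))} (hA : A ≠ Finset.univ) : gate k A ∉ A := by
  have h : ∃ g, g ∉ A := by
    by_contra! h
    exact hA (Finset.eq_univ_iff_forall.mpr h)
  rw [gate, dif_pos h]
  exact h.choose_spec

theorem mem_decWord {A : Finset (ZMod (k + 1))} {a : ZMod (k + 1)} : a ∈ decWord k A ↔ a ∈ A := by
  simp only [decWord, List.mem_filter, List.mem_map, List.mem_reverse, List.mem_range,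
    decide_eq_true_eq, and_iff_right_iff_imp]
  exact fun _ => ⟨(a - gate k A).val, ZMod.val_lt _, by simp⟩

theorem natCast_inj_of_lt {t u : ℕ} (ht : t < k + 1) (hu : u < k + 1)
    (h : (t : ZMod (k + 1)) = u) : t = u := by
  rwa [ZMod.natCast_eq_natCast_iff', Nat.mod_eq_of_lt ht, Nat.mod_eq_of_lt hu] at h

theorem natCast_ne_of_lt {t u : ℕ} (htu : t < u) (hu : u < t + (k + 1)) :
    (u : ZMod (k + 1)) ≠ t := by
  intro h
  have h1 := (Nat.modEq_iff_dvd' htu.le).mp ((ZMod.natCast_eq_natCast_iff t u (k + 1)).mp h.symm)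
  have := Nat.le_of_dvd (by omega) h1
  omega

theorem nodup_decWord (A : Finset (ZMod (k + 1))) : (decWord k A).Nodup := by
  refine List.Nodup.filter _ (List.Nodup.map_on ?_ (List.nodup_reverse.mpr List.nodup_range))
  intro t ht u hu h
  simp only [List.mem_reverse, List.mem_range] at ht hu
  exact natCast_inj_of_lt ht hu (add_left_cancel h)

theorem length_decWord (A : Finset (ZMod (k + 1))) : (decWord k A).length = A.card := by
  rw [← List.toFinset_card_of_nodup (nodup_decWord A)]
  congr 1
  ext a
  simp [mem_decWord]

theorem pairwise_decWord {A : Finset (ZMod (k + 1))} (hA : A ≠ Finset.univ) :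
    (decWord k A).Pairwise fun a b => b ≠ a + 1 := by
  rw [decWord, List.pairwise_filter, List.pairwise_map, List.pairwise_reverse]
  refine List.pairwise_lt_range.imp_of_mem ?_
  intro u t hu ht hut h1 h2 h3
  simp only [List.mem_range, decide_eq_true_eq] at hu ht h1 h2
  rw [add_assoc] at h3
  have h4 : ((u : ℕ) : ZMod (k + 1)) = ((t + 1 : ℕ) : ZMod (k + 1)) := by
    push_cast
    exact add_left_cancel h3
  rcases Nat.lt_or_ge (t + 1) (k + 1) with h | h
  · have := natCast_inj_of_lt hu h h4
    omega
  · have h5 : t + 1 = k + 1 := by omega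
    rw [h5, ZMod.natCast_self] at h4
    rw [h4, add_zero] at h2
    exact gate_notMem hA h2

theorem exists_perm_CRD_of_reduced (hk : 1 ≤ k) (l : List (ZMod (k + 1))) (hl : l.Nodup)
    (hl' : l.Pairwise fun a b => b ≠ a + 1) {y : Equiv.Perm ℤ} (hy : IsBalanced k y)
    (hlen : codeSize k (y * (l.map (sAff k)).prod) = codeSize k y + l.length) :
    ∃ σ : Equiv.Perm (ZMod (k + 1)),
      (∀ j, CRD k (y * (l.map (sAff k)).prod) (σ j) = CRD k y j + if j ∈ l then 1 else 0) ∧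
      (∀ j ∈ l, σ j = j + 1) ∧ ∀ m, m ∉ l → m - 1 ∉ l → σ m = m := by
  induction l generalizing y with
  | nil => exact ⟨1, by simp⟩
  | cons i l ih =>
    rw [List.nodup_cons] at hl
    rw [List.pairwise_cons] at hl'
    have hi : i + 1 ∉ l := fun h => hl'.1 _ h rfl
    rw [List.map_cons, List.prod_cons, ← mul_assoc, List.length_cons] at hlen
    have hle := codeSize_mul_word_le hk l (hy.mul_sAff hk i)
    have hasc : CRD k y (i + 1) ≤ CRD k y i := by
      by_contra! h
      have := codeSize_eq_mul_sAff_add_one hk hy h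
      omega
    have hs := codeSize_mul_sAff hk hy hasc
    obtain ⟨σ, h1, h2, h3⟩ := ih hl.2 hl'.2 (hy.mul_sAff hk i) (by omega)
    have hswap : ∀ j, j ≠ i → j ≠ i + 1 → Equiv.swap i (i + 1) j = j := fun j =>
      Equiv.swap_apply_of_ne_of_ne
    refine ⟨σ * Equiv.swap i (i + 1), fun j => ?_, fun j hj => ?_, fun m hm hm' => ?_⟩
    · rw [List.map_cons, List.prod_cons, ← mul_assoc, Equiv.Perm.mul_apply, h1,
        CRD_mul_sAff hk hy hasc, add_assoc]
      congr 1
      have hne : i + 1 ≠ i := by simpa using one_ne_zero_zmod hk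
      by_cases hji : j = i
      · subst hji
        simp [hi]
      · by_cases hji' : j = i + 1
        · subst hji'
          simp [hi, hl.1, hne]
        · simp [hswap j hji hji', hji]
    · rw [Equiv.Perm.mul_apply]
      rcases List.mem_cons.mp hj with rfl | hj
      · rw [Equiv.swap_apply_left]
        exact h3 _ hi (by simpa using hl.1)
      · rw [hswap j (fun h => hl.1 (h ▸ hj)) (fun h => hi (h ▸ hj)), h2 j hj]
    · simp only [List.mem_cons, not_or] at hm hm'
      rw [Equiv.Perm.mul_apply, hswap m hm.1 (fun h => hm'.1 (by rw [h]; ring))]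
      exact h3 m hm.2 hm'.2

theorem codeSize_mul_dElt_le (hk : 1 ≤ k) (A : Finset (ZMod (k + 1))) {y : Equiv.Perm ℤ}
    (hy : IsBalanced k y) : codeSize k (y * dElt k A) ≤ codeSize k y + A.card := by
  rw [← length_decWord A]
  exact codeSize_mul_word_le hk _ hy

theorem IsBalanced.mul_dElt (hk : 1 ≤ k) {y : Equiv.Perm ℤ} (hy : IsBalanced k y)
    (A : Finset (ZMod (k + 1))) : IsBalanced k (y * dElt k A) :=
  hy.mul_word hk _

/-- The support of the right decreasing code, shifted down by one. -/
noncomputable def shiftedSupport (k : ℕ) (x : Equiv.Perm ℤ) : Finset (ZMod (k + 1)) :=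
  Finset.univ.filter fun r => CRD k x (r + 1) ≠ 0

theorem mem_shiftedSupport {x : Equiv.Perm ℤ} {r : ZMod (k + 1)} :
    r ∈ shiftedSupport k x ↔ CRD k x (r + 1) ≠ 0 := by
  simp [shiftedSupport]

theorem shiftedSupport_ne_univ {x : Equiv.Perm ℤ} (hx : IsBalanced k x) :
    shiftedSupport k x ≠ Finset.univ := by
  obtain ⟨r, hr⟩ := exists_CRD_eq_zero hx.1
  intro h
  have h1 := Finset.mem_univ (r - 1)
  rw [← h, mem_shiftedSupport, sub_add_cancel] at h1
  exact h1 hr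

theorem shiftedSupport_one : shiftedSupport k 1 = ∅ := by
  have h := codeSize_one (k := k)
  rw [codeSize, Finset.sum_eq_zero_iff] at h
  ext r
  simp [mem_shiftedSupport, h (r + 1) (Finset.mem_univ _)]

theorem eq_one_of_shiftedSupport_eq_empty (hk : 1 ≤ k) {x : Equiv.Perm ℤ} (hx : IsBalanced k x)
    (h : shiftedSupport k x = ∅) : x = 1 := by
  refine eq_one_of_CRD_antitone hk hx fun r => ?_
  have hr : r ∉ shiftedSupport k x := by simp [h]
  rw [mem_shiftedSupport, not_not] at hr
  omega

theorem subset_shiftedSupport (hk : 1 ≤ k) {A : Finset (ZMod (k + 1))} (hA : A ≠ Finset.univ)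
    {y : Equiv.Perm ℤ} (hy : IsBalanced k y)
    (hlen : codeSize k (y * dElt k A) = codeSize k y + A.card) :
    A ⊆ shiftedSupport k (y * dElt k A) := by
  rw [← length_decWord A] at hlen
  obtain ⟨σ, h1, h2, -⟩ :=
    exists_perm_CRD_of_reduced hk _ (nodup_decWord A) (pairwise_decWord hA) hy hlen
  intro a ha
  have ha' := mem_decWord.mpr ha
  have h := h1 a
  rw [h2 a ha', if_pos ha'] at h
  rw [mem_shiftedSupport, dElt_eq_prod_decWord, h]
  omega

theorem shiftedSupport_subset_shift_iff (hk : 1 ≤ k) {A : Finset (ZMod (k + 1))}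
    (hA : A ≠ Finset.univ) {y : Equiv.Perm ℤ} (hy : IsBalanced k y)
    (hlen : codeSize k (y * dElt k A) = codeSize k y + A.card) :
    shiftedSupport k y ⊆ A.image (fun a => a - 1) ↔ A = shiftedSupport k (y * dElt k A) := by
  have hsub := subset_shiftedSupport hk hA hy hlen
  rw [← length_decWord A] at hlen
  obtain ⟨σ, h1, h2, -⟩ :=
    exists_perm_CRD_of_reduced hk _ (nodup_decWord A) (pairwise_decWord hA) hy hlen
  simp only [mem_decWord, ← dElt_eq_prod_decWord] at h1 h2
  constructor
  · intro h
    refine hsub.antisymm fun r hr => ?_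
    obtain ⟨j, hj⟩ := σ.surjective (r + 1)
    rw [mem_shiftedSupport, ← hj, h1] at hr
    have hjA : j ∈ A := by
      by_contra hjA
      rw [if_neg hjA, add_zero] at hr
      have hmem : j - 1 ∈ shiftedSupport k y := by rwa [mem_shiftedSupport, sub_add_cancel]
      obtain ⟨a, ha, haj⟩ := Finset.mem_image.mp (h hmem)
      exact hjA (sub_left_injective haj ▸ ha)
    rw [h2 j hjA] at hj
    exact add_right_cancel hj ▸ hjA
  · intro h r hr
    rw [mem_shiftedSupport] at hr
    refine Finset.mem_image.mpr ⟨r + 1, ?_, by ring⟩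
    have hmem : σ (r + 1) - 1 ∈ A := by
      rw [h, mem_shiftedSupport, sub_add_cancel, h1]
      omega
    have h3 := h2 _ hmem
    rw [sub_add_cancel] at h3
    exact σ.injective h3 ▸ hmem

theorem exists_eq_mul_dElt_shiftedSupport (hk : 1 ≤ k) {x : Equiv.Perm ℤ} (hx : IsBalanced k x) :
    ∃ y, IsBalanced k y ∧ x = y * dElt k (shiftedSupport k x) ∧
      codeSize k x = codeSize k y + (shiftedSupport k x).card := by
  set A := shiftedSupport k x
  have hA : A ≠ Finset.univ := shiftedSupport_ne_univ hx
  set g := gate k A with hg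
  have hgA : g ∉ A := gate_notMem hA
  have hmemA : ∀ r, r ∈ A ↔ CRD k x (r + 1) ≠ 0 := fun r => mem_shiftedSupport
  let w : ℕ → List (ZMod (k + 1)) := fun t =>
    ((List.range t).map fun u : ℕ => g + (u : ZMod (k + 1))).filter fun a => decide (a ∈ A)
  have hword : (w (k + 1)) = (decWord k A).reverse := by
    simp only [w, decWord, ← hg]
    rw [List.map_reverse, List.filter_reverse, List.reverse_reverse]
  have hinv : ∀ l : List (ZMod (k + 1)),
      (l.reverse.map (sAff k)).prod * (l.map (sAff k)).prod = 1 := by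
    intro l
    induction l with
    | nil => simp
    | cons i l ih =>
      rw [List.reverse_cons, List.map_append, List.prod_append,
        List.map_singleton, List.prod_singleton, List.map_cons, List.prod_cons, mul_assoc,
        ← mul_assoc (sAff k i), sAff_mul_self hk, one_mul, ih]
  have step : ∀ t, 1 ≤ t → t ≤ k + 1 →
      CRD k (x * ((w t).map (sAff k)).prod) (g + (t : ZMod (k + 1))) = 0 ∧
      (∀ u, t < u → u ≤ k + 1 → CRD k (x * ((w t).map (sAff k)).prod) (g + (u : ZMod (k + 1))) =
        CRD k x (g + (u : ZMod (k + 1)))) ∧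
      codeSize k x = codeSize k (x * ((w t).map (sAff k)).prod) + (w t).length := by
    intro t ht
    induction t, ht using Nat.le_induction with
    | base =>
      intro _
      have h1 : w 1 = [] := by simp [w, hgA]
      rw [h1]
      have h2 := mt (hmemA g).mpr hgA
      exact ⟨by simpa using h2, by simp, by simp⟩
    | succ t ht ih =>
      intro htk
      obtain ⟨h1, h2, h3⟩ := ih (by omega)
      have hbal := hx.mul_word hk (w t)
      have hcast : g + ((t + 1 : ℕ) : ZMod (k + 1)) = g + t + 1 := by push_cast; ring
      have h4 := h2 (t + 1) (by omega) htk
      have hw : w (t + 1) = w t ++ [g + (t : ZMod (k + 1))].filter fun a => decide (a ∈ A) := by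
        simp only [w, List.range_succ, List.map_append, List.filter_append, List.map_singleton]
      rw [hcast] at h4 ⊢
      by_cases hmem : g + (t : ZMod (k + 1)) ∈ A
      · have hpos := (hmemA _).mp hmem
        have hw' : w (t + 1) = w t ++ [g + (t : ZMod (k + 1))] := by rw [hw]; simp [hmem]
        have hdesc : CRD k (x * ((w t).map (sAff k)).prod) (g + t) <
            CRD k (x * ((w t).map (sAff k)).prod) (g + t + 1) := by omega
        have hne : g + (t : ZMod (k + 1)) + 1 ≠ g + t := by simpa using one_ne_zero_zmod hk
        rw [hw', List.map_append, List.prod_append, List.map_singleton, List.prod_singleton,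
          ← mul_assoc, List.length_append, List.length_singleton]
        refine ⟨?_, fun u hu huk => ?_, ?_⟩
        · have h5 := CRD_swap hk hbal hdesc (g + t + 1)
          rw [Equiv.swap_apply_right, h1, if_neg hne] at h5
          omega
        · have hu1 : g + (u : ZMod (k + 1)) ≠ g + t := by
            exact fun h => natCast_ne_of_lt (by omega) (by omega) (add_left_cancel h)
          have hu2 : g + (u : ZMod (k + 1)) ≠ g + t + 1 := by
            rw [← hcast]
            exact fun h => natCast_ne_of_lt (by omega) (by omega) (add_left_cancel h)
          have h5 := CRD_swap hk hbal hdesc (g + u)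
          rw [Equiv.swap_apply_of_ne_of_ne hu1 hu2, if_neg hu1, add_zero] at h5
          rw [← h5]
          exact h2 u (by omega) huk
        · have := codeSize_eq_mul_sAff_add_one hk hbal hdesc
          omega
      · have hw' : w (t + 1) = w t := by rw [hw]; simp [hmem]
        rw [hw']
        refine ⟨?_, fun u hu huk => h2 u (by omega) huk, h3⟩
        rw [h4]
        exact not_not.mp (mt (hmemA _).mpr hmem)
  obtain ⟨-, -, h⟩ := step (k + 1) (by omega) le_rfl
  refine ⟨x * ((w (k + 1)).map (sAff k)).prod, hx.mul_word hk _, ?_, ?_⟩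
  · rw [dElt_eq_prod_decWord, mul_assoc, hword, hinv, mul_one]
  · rwa [hword, List.length_reverse, length_decWord, ← hword] at h

/-! ### Reduced cyclically decreasing decompositions -/

/-- `L = [A₁, …, Aₙ]` gives a reduced decomposition `x = d_{Aₙ} ⋯ d_{A₁}`. -/
def IsReducedDecomp (k : ℕ) (x : Equiv.Perm ℤ) (L : List (Finset (ZMod (k + 1)))) : Prop :=
  (∀ A ∈ L, A.Nonempty ∧ A ≠ Finset.univ) ∧ x = (L.reverse.map (dElt k)).prod ∧
    codeSize k x = (L.map Finset.card).sum

theorem prod_reverse_cons (A : Finset (ZMod (k + 1))) (L : List (Finset (ZMod (k + 1)))) :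
    ((A :: L).reverse.map (dElt k)).prod = (L.reverse.map (dElt k)).prod * dElt k A := by
  simp

theorem isBalanced_prod_reverse (hk : 1 ≤ k) (L : List (Finset (ZMod (k + 1)))) :
    IsBalanced k (L.reverse.map (dElt k)).prod := by
  induction L with
  | nil => simpa using isBalanced_one
  | cons A L ih => rw [prod_reverse_cons]; exact ih.mul_dElt hk A

theorem codeSize_prod_reverse_le (hk : 1 ≤ k) (L : List (Finset (ZMod (k + 1)))) :
    codeSize k (L.reverse.map (dElt k)).prod ≤ (L.map Finset.card).sum := by
  induction L with
  | nil => simp [codeSize_one]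
  | cons A L ih =>
    have := codeSize_mul_dElt_le hk A (isBalanced_prod_reverse hk L)
    rw [prod_reverse_cons, List.map_cons, List.sum_cons]
    omega

theorem IsReducedDecomp.isBalanced (hk : 1 ≤ k) {x : Equiv.Perm ℤ}
    {L : List (Finset (ZMod (k + 1)))} (h : IsReducedDecomp k x L) : IsBalanced k x :=
  h.2.1 ▸ isBalanced_prod_reverse hk L

theorem isReducedDecomp_nil {x : Equiv.Perm ℤ} : IsReducedDecomp k x [] ↔ x = 1 := by
  constructor
  · exact fun h => by simpa using h.2.1
  · rintro rfl
    exact ⟨by simp, by simp, by simp [codeSize_one]⟩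

theorem IsReducedDecomp.of_cons (hk : 1 ≤ k) {x : Equiv.Perm ℤ} {A : Finset (ZMod (k + 1))}
    {L : List (Finset (ZMod (k + 1)))} (h : IsReducedDecomp k x (A :: L)) :
    ∃ y, IsReducedDecomp k y L ∧ x = y * dElt k A ∧ codeSize k x = codeSize k y + A.card := by
  obtain ⟨h1, h2, h3⟩ := h
  rw [prod_reverse_cons] at h2
  rw [List.map_cons, List.sum_cons] at h3
  have h4 := codeSize_mul_dElt_le hk A (isBalanced_prod_reverse hk L)
  have h5 := codeSize_prod_reverse_le hk L
  rw [← h2] at h4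
  exact ⟨_, ⟨fun B hB => h1 B (List.mem_cons_of_mem _ hB), rfl, by omega⟩, h2, by omega⟩

theorem IsReducedDecomp.cons {y : Equiv.Perm ℤ} {A : Finset (ZMod (k + 1))}
    {L : List (Finset (ZMod (k + 1)))} (h : IsReducedDecomp k y L) (hA : A.Nonempty)
    (hA' : A ≠ Finset.univ) (hlen : codeSize k (y * dElt k A) = codeSize k y + A.card) :
    IsReducedDecomp k (y * dElt k A) (A :: L) := by
  obtain ⟨h1, h2, h3⟩ := h
  refine ⟨?_, by rw [prod_reverse_cons, ← h2], by
    rw [hlen, h3, List.map_cons, List.sum_cons, add_comm]⟩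
  intro B hB
  rcases List.mem_cons.mp hB with rfl | hB
  · exact ⟨hA, hA'⟩
  · exact h1 B hB

theorem exists_isReducedDecomp (hk : 1 ≤ k) {x : Equiv.Perm ℤ} (hx : IsBalanced k x) :
    ∃ L, IsReducedDecomp k x L := by
  by_cases h : shiftedSupport k x = ∅
  · exact ⟨[], isReducedDecomp_nil.mpr (eq_one_of_shiftedSupport_eq_empty hk hx h)⟩
  · have hne := Finset.nonempty_iff_ne_empty.mpr h
    obtain ⟨y, hy, hxy, hlen⟩ := exists_eq_mul_dElt_shiftedSupport hk hx
    have hcard := hne.card_pos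
    obtain ⟨L, hL⟩ := exists_isReducedDecomp hk hy
    have h2 := hL.cons hne (shiftedSupport_ne_univ hx) (by rw [← hxy, hlen])
    rw [← hxy] at h2
    exact ⟨_, h2⟩
termination_by codeSize k x

/-- Lexicographic comparison of two sequences padded with zeros. -/
def PaddedLexGE (a b : List ℕ) : Prop :=
  (∀ m : ℕ, a.getD m 0 = b.getD m 0) ∨
    ∃ m : ℕ, (∀ t : ℕ, t < m → a.getD t 0 = b.getD t 0) ∧ b.getD m 0 < a.getD m 0

theorem paddedLexGE_of_head_lt {p : ℕ} {a b : List ℕ} (h : b.getD 0 0 < p) :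
    PaddedLexGE (p :: a) b :=
  Or.inr ⟨0, by simp, by simpa using h⟩

theorem PaddedLexGE.head_le {a b : List ℕ} (h : PaddedLexGE a b) : b.getD 0 0 ≤ a.getD 0 0 := by
  rcases h with h | ⟨m, h1, h2⟩
  · exact (h 0).ge
  · rcases Nat.eq_zero_or_pos m with rfl | hm
    · exact h2.le
    · exact (h1 0 hm).ge

theorem paddedLexGE_cons_cons {p : ℕ} {a b : List ℕ} :
    PaddedLexGE (p :: a) (p :: b) ↔ PaddedLexGE a b := by
  constructor
  · rintro (h | ⟨m, h1, h2⟩)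
    · exact Or.inl fun m => by simpa using h (m + 1)
    · cases m with
      | zero => simp at h2
      | succ m =>
        exact Or.inr ⟨m, fun t ht => by simpa using h1 (t + 1) (by omega), by simpa using h2⟩
  · rintro (h | ⟨m, h1, h2⟩)
    · refine Or.inl fun m => ?_
      cases m with
      | zero => rfl
      | succ m => simpa using h m
    · refine Or.inr ⟨m + 1, fun t ht => ?_, by simpa using h2⟩
      cases t with
      | zero => rfl
      | succ t => simpa using h1 t (by omega)

theorem isChain_cons_iff_headD {α : Type*} {A : Finset α} {f : Finset α → Finset α}
    {L : List (Finset α)} :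
    List.IsChain (fun A B => B ⊆ f A) (A :: L) ↔
      L.headD ∅ ⊆ f A ∧ List.IsChain (fun A B => B ⊆ f A) L := by
  cases L <;> simp

theorem headD_eq_shiftedSupport (hk : 1 ≤ k) {L : List (Finset (ZMod (k + 1)))} {x : Equiv.Perm ℤ}
    (h : IsReducedDecomp k x L)
    (hc : List.IsChain (fun A B => B ⊆ A.image (fun a => a - 1)) L) :
    L.headD ∅ = shiftedSupport k x := by
  induction L generalizing x with
  | nil => rw [isReducedDecomp_nil.mp h, shiftedSupport_one]; rfl
  | cons A L ih =>
    obtain ⟨y, hy, rfl, hlen⟩ := h.of_cons hk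
    rw [isChain_cons_iff_headD] at hc
    rw [ih hy hc.2] at hc
    exact (shiftedSupport_subset_shift_iff hk (h.1 A (by simp)).2 (hy.isBalanced hk) hlen).mp hc.1

theorem paddedLexGE_of_isChain (hk : 1 ≤ k) {L M : List (Finset (ZMod (k + 1)))}
    {x : Equiv.Perm ℤ} (hL : IsReducedDecomp k x L) (hM : IsReducedDecomp k x M)
    (hc : List.IsChain (fun A B => B ⊆ A.image (fun a => a - 1)) L) :
    PaddedLexGE (L.map Finset.card) (M.map Finset.card) := by
  induction L generalizing x M with
  | nil =>
    rw [isReducedDecomp_nil] at hL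
    subst hL
    cases M with
    | nil => exact Or.inl fun _ => rfl
    | cons B M =>
      have h1 := hM.2.2
      have h2 := (hM.1 B (by simp)).1.card_pos
      rw [codeSize_one, List.map_cons, List.sum_cons] at h1
      omega
  | cons A L ih =>
    have hA := headD_eq_shiftedSupport hk hL hc
    rw [List.headD_cons] at hA
    cases M with
    | nil => exact paddedLexGE_of_head_lt (hL.1 A (by simp)).1.card_pos
    | cons B M =>
      obtain ⟨y, hy, rfl, -⟩ := hL.of_cons hk
      obtain ⟨z, hz, hzy, hzlen⟩ := hM.of_cons hk
      have hsub : B ⊆ A := by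
        rw [hA, hzy]
        rw [hzy] at hzlen
        exact subset_shiftedSupport hk (hM.1 B (by simp)).2 (hz.isBalanced hk) hzlen
      rcases (Finset.card_le_card hsub).lt_or_eq with h | h
      · exact paddedLexGE_of_head_lt (by simpa using h)
      · have hBA := Finset.eq_of_subset_of_card_le hsub h.ge
        subst hBA
        rw [← mul_right_cancel hzy] at hz
        exact paddedLexGE_cons_cons.mpr (ih hy hz (isChain_cons_iff_headD.mp hc).2)

theorem isChain_of_forall_paddedLexGE (hk : 1 ≤ k) {L : List (Finset (ZMod (k + 1)))}
    {x : Equiv.Perm ℤ} (hL : IsReducedDecomp k x L)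
    (h : ∀ M, IsReducedDecomp k x M → PaddedLexGE (L.map Finset.card) (M.map Finset.card)) :
    List.IsChain (fun A B => B ⊆ A.image (fun a => a - 1)) L := by
  induction L generalizing x with
  | nil => exact List.isChain_nil
  | cons A L ih =>
    have hx := hL.isBalanced hk
    obtain ⟨hA, hA'⟩ := hL.1 A (by simp)
    obtain ⟨y, hy, rfl, hlen⟩ := hL.of_cons hk
    have hybal := hy.isBalanced hk
    have hsub := subset_shiftedSupport hk hA' hybal hlen
    obtain ⟨z, hz, hyz, hzlen⟩ := exists_eq_mul_dElt_shiftedSupport hk hx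
    obtain ⟨M, hM⟩ := exists_isReducedDecomp hk hz
    have hM' := hM.cons (hA.mono hsub) (shiftedSupport_ne_univ hx) (by rw [← hyz, hzlen])
    rw [← hyz] at hM'
    have hcard : (shiftedSupport k (y * dElt k A)).card ≤ A.card := by
      simpa using (h _ hM').head_le
    have hAeq := Finset.eq_of_subset_of_card_le hsub hcard
    have hchain := ih hy fun N hN => paddedLexGE_cons_cons.mp (h _ (hN.cons hA hA' hlen))
    rw [isChain_cons_iff_headD, headD_eq_shiftedSupport hk hy hchain]
    exact ⟨(shiftedSupport_subset_shift_iff hk hA' hybal hlen).mpr hAeq, hchain⟩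

end PeriodicPermutations

/-- a reduced cyclically decreasing decomposition satisfies the shifted
containment condition iff its shape is lexicographically maximal among all reduced
cyclically decreasing decompositions of `x`. -/
theorem maximal_iff_shifted_containment (k : ℕ) (hk : 1 ≤ k) (x : Equiv.Perm ℤ)
    (hx : IsAffinePerm k x) (L : List (Finset (ZMod (k + 1))))
    (hL : ∀ A ∈ L, A.Nonempty ∧ A ≠ Finset.univ)
    (hprod : x = (L.reverse.map (dElt k)).prod)
    (hlen : affLen k x = (L.map Finset.card).sum) :
    List.Chain' (fun A B => B ⊆ A.image (fun a => a - 1)) L ↔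
      ∀ M : List (Finset (ZMod (k + 1))),
        (∀ B ∈ M, B.Nonempty ∧ B ≠ Finset.univ) →
        x = (M.reverse.map (dElt k)).prod →
        affLen k x = (M.map Finset.card).sum →
        ((∀ m : ℕ, (L.map Finset.card).getD m 0 = (M.map Finset.card).getD m 0) ∨
          ∃ m : ℕ, (∀ t : ℕ, t < m →
              (L.map Finset.card).getD t 0 = (M.map Finset.card).getD t 0) ∧
            (M.map Finset.card).getD m 0 < (L.map Finset.card).getD m 0) := by
  have hbal : IsBalanced k x := hprod ▸ isBalanced_prod_reverse hk L
  rw [affLen_eq_codeSize hk hbal] at hlen ⊢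
  have hred : IsReducedDecomp k x L := ⟨hL, hprod, hlen⟩
  exact ⟨fun hc M h1 h2 h3 => paddedLexGE_of_isChain hk hred ⟨h1, h2, h3⟩ hc,
    fun h => isChain_of_forall_paddedLexGE hk hred fun M hM => h M hM.1 hM.2.1 hM.2.2⟩
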